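/- For every z in the upper half-plane ℍ: Φ4(x1(z),…,x6(z)) = 0. -/

import Mathlib

open Complex Finset

noncomputable section

/-- `ζ = exp(2πi/13)`. -/
def zeta13 : ℂ := Complex.exp (2 * Real.pi * Complex.I / 13)

local notation "ζ" => zeta13

/-- The diagonal matrix `T = diag(ζ^7, ζ^11, ζ^8, ζ^6, ζ^2, ζ^5)`. -/
def Tmat : Matrix (Fin 6) (Fin 6) ℂ :=
  Matrix.diagonal ![ζ ^ 7, ζ ^ 11, ζ ^ 8, ζ ^ 6, ζ ^ 2, ζ ^ 5]

/-- The matrix `S = -(1/√13)·M`. -/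
def Smat : Matrix (Fin 6) (Fin 6) ℂ :=
  (-(1 / (Real.sqrt 13 : ℂ))) • Matrix.of
    ![![ζ^12 - ζ, ζ^10 - ζ^3, ζ^4 - ζ^9, ζ^5 - ζ^8, ζ^2 - ζ^11, ζ^6 - ζ^7],
      ![ζ^10 - ζ^3, ζ^4 - ζ^9, ζ^12 - ζ, ζ^2 - ζ^11, ζ^6 - ζ^7, ζ^5 - ζ^8],
      ![ζ^4 - ζ^9, ζ^12 - ζ, ζ^10 - ζ^3, ζ^6 - ζ^7, ζ^5 - ζ^8, ζ^2 - ζ^11],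
      ![ζ^5 - ζ^8, ζ^2 - ζ^11, ζ^6 - ζ^7, ζ - ζ^12, ζ^3 - ζ^10, ζ^9 - ζ^4],
      ![ζ^2 - ζ^11, ζ^6 - ζ^7, ζ^5 - ζ^8, ζ^3 - ζ^10, ζ^9 - ζ^4, ζ - ζ^12],
      ![ζ^6 - ζ^7, ζ^5 - ζ^8, ζ^2 - ζ^11, ζ^9 - ζ^4, ζ - ζ^12, ζ^3 - ζ^10]]

/-- The matrix `H`, mapping `(z1,…,z6)` to `(z6, z4, z5, −z3, −z1, −z2)`. -/
def Hmat : Matrix (Fin 6) (Fin 6) ℂ :=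
  Matrix.of
    ![![0,0,0,0,0,1], ![0,0,0,1,0,0], ![0,0,0,0,1,0],
      ![0,0,-1,0,0,0], ![-1,0,0,0,0,0], ![0,-1,0,0,0,0]]

/-- The senary quadratic forms `A_0, …, A_6` (here `v 0 = z1, …, v 5 = z6`). -/
def A : ℕ → (Fin 6 → ℂ) → ℂ
  | 0, v => v 0 * v 3 + v 1 * v 4 + v 2 * v 5
  | 1, v => v 0 ^ 2 - 2 * v 2 * v 3
  | 2, v => -v 4 ^ 2 - 2 * v 1 * v 3
  | 3, v => v 1 ^ 2 - 2 * v 0 * v 4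
  | 4, v => v 2 ^ 2 - 2 * v 1 * v 5
  | 5, v => -v 3 ^ 2 - 2 * v 0 * v 5
  | 6, v => -v 5 ^ 2 - 2 * v 2 * v 4
  | _, _ => 0

/-- `w_ν = (A0 + ζ^ν A1 + ζ^{4ν} A2 + ζ^{9ν} A3 + ζ^{3ν} A4 + ζ^{12ν} A5 + ζ^{10ν} A6)^2`. -/
def w (ν : ℕ) (v : Fin 6 → ℂ) : ℂ :=
  (A 0 v + ζ ^ ν * A 1 v + ζ ^ (4 * ν) * A 2 v + ζ ^ (9 * ν) * A 3 v +
    ζ ^ (3 * ν) * A 4 v + ζ ^ (12 * ν) * A 5 v + ζ ^ (10 * ν) * A 6 v) ^ 2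

/-- `w_∞ = 13·A0^2`. -/
def winf (v : Fin 6 → ℂ) : ℂ := 13 * A 0 v ^ 2

/-- The senary cubic forms `D_0, …, D_12` (here `v 0 = z1, …, v 5 = z6`). -/
def D : ℕ → (Fin 6 → ℂ) → ℂ
  | 0, v => v 0 * v 1 * v 2
  | 1, v => 2 * v 1 * v 2 ^ 2 + v 1 ^ 2 * v 5 - v 3 ^ 2 * v 4 + v 0 * v 4 * v 5
  | 2, v => -v 5 ^ 3 + v 1 ^ 2 * v 3 - 2 * v 1 * v 4 ^ 2 + v 0 * v 3 * v 4 + 3 * v 2 * v 4 * v 5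
  | 3, v => 2 * v 0 * v 1 ^ 2 + v 0 ^ 2 * v 4 - v 3 * v 5 ^ 2 + v 2 * v 3 * v 4
  | 4, v => -v 1 ^ 2 * v 2 + v 0 * v 5 ^ 2 - 2 * v 3 ^ 2 * v 5 - v 0 * v 2 * v 4
  | 5, v => -v 3 ^ 3 + v 2 ^ 2 * v 4 - 2 * v 2 * v 5 ^ 2 + v 1 * v 4 * v 5 + 3 * v 0 * v 3 * v 5
  | 6, v => -v 4 ^ 3 + v 0 ^ 2 * v 5 - 2 * v 0 * v 3 ^ 2 + v 2 * v 3 * v 5 + 3 * v 1 * v 3 * v 4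
  | 7, v => -v 1 ^ 3 + v 2 * v 3 ^ 2 - v 0 * v 2 * v 5 - 3 * v 0 * v 1 * v 4 + 2 * v 0 ^ 2 * v 3
  | 8, v => -v 0 ^ 3 + v 1 * v 5 ^ 2 - v 1 * v 2 * v 4 - 3 * v 0 * v 2 * v 3 + 2 * v 2 ^ 2 * v 5
  | 9, v => 2 * v 0 ^ 2 * v 2 + v 2 ^ 2 * v 3 - v 4 ^ 2 * v 5 + v 1 * v 3 * v 5
  | 10, v => -v 0 * v 2 ^ 2 + v 1 * v 3 ^ 2 - 2 * v 3 * v 4 ^ 2 - v 0 * v 1 * v 5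
  | 11, v => -v 2 ^ 3 + v 0 * v 4 ^ 2 - v 0 * v 1 * v 3 - 3 * v 1 * v 2 * v 5 + 2 * v 1 ^ 2 * v 4
  | 12, v => -v 0 ^ 2 * v 1 + v 2 * v 4 ^ 2 - 2 * v 4 * v 5 ^ 2 - v 1 * v 2 * v 3
  | _, _ => 0

/-- The senary cubic form `D_∞ = z4 z5 z6`. -/
def Dinf (v : Fin 6 → ℂ) : ℂ := v 3 * v 4 * v 5

/-- The senary sextic forms `G_0, …, G_12`. -/
def Gs : ℕ → (Fin 6 → ℂ) → ℂ
  | 0, v => D 0 v ^ 2 + Dinf v ^ 2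
  | 1, v => -D 7 v ^ 2 + 2 * D 0 v * D 1 v + 10 * Dinf v * D 1 v + 2 * D 2 v * D 12 v
      - 2 * D 3 v * D 11 v - 4 * D 4 v * D 10 v - 2 * D 9 v * D 5 v
  | 2, v => -2 * D 1 v ^ 2 - 4 * D 0 v * D 2 v + 6 * Dinf v * D 2 v - 2 * D 4 v * D 11 v
      + 2 * D 5 v * D 10 v - 2 * D 6 v * D 9 v - 2 * D 7 v * D 8 v
  | 3, v => -D 8 v ^ 2 + 2 * D 0 v * D 3 v + 10 * Dinf v * D 3 v + 2 * D 6 v * D 10 v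
      - 2 * D 9 v * D 7 v - 4 * D 12 v * D 4 v - 2 * D 1 v * D 2 v
  | 4, v => -D 2 v ^ 2 + 10 * D 0 v * D 4 v - 2 * Dinf v * D 4 v + 2 * D 5 v * D 12 v
      - 2 * D 9 v * D 8 v - 4 * D 1 v * D 3 v - 2 * D 10 v * D 7 v
  | 5, v => -2 * D 9 v ^ 2 - 4 * D 0 v * D 5 v + 6 * Dinf v * D 5 v - 2 * D 10 v * D 8 v
      + 2 * D 6 v * D 12 v - 2 * D 2 v * D 3 v - 2 * D 11 v * D 7 v
  | 6, v => -2 * D 3 v ^ 2 - 4 * D 0 v * D 6 v + 6 * Dinf v * D 6 v - 2 * D 12 v * D 7 v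
      + 2 * D 2 v * D 4 v - 2 * D 5 v * D 1 v - 2 * D 8 v * D 11 v
  | 7, v => -2 * D 10 v ^ 2 + 6 * D 0 v * D 7 v + 4 * Dinf v * D 7 v - 2 * D 1 v * D 6 v
      - 2 * D 2 v * D 5 v - 2 * D 8 v * D 12 v - 2 * D 9 v * D 11 v
  | 8, v => -2 * D 4 v ^ 2 + 6 * D 0 v * D 8 v + 4 * Dinf v * D 8 v - 2 * D 3 v * D 5 v
      - 2 * D 6 v * D 2 v - 2 * D 11 v * D 10 v - 2 * D 1 v * D 7 v
  | 9, v => -D 11 v ^ 2 + 2 * D 0 v * D 9 v + 10 * Dinf v * D 9 v + 2 * D 5 v * D 4 v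
      - 2 * D 1 v * D 8 v - 4 * D 10 v * D 12 v - 2 * D 3 v * D 6 v
  | 10, v => -D 5 v ^ 2 + 10 * D 0 v * D 10 v - 2 * Dinf v * D 10 v + 2 * D 6 v * D 4 v
      - 2 * D 3 v * D 7 v - 4 * D 9 v * D 1 v - 2 * D 12 v * D 11 v
  | 11, v => -2 * D 12 v ^ 2 + 6 * D 0 v * D 11 v + 4 * Dinf v * D 11 v - 2 * D 9 v * D 2 v
      - 2 * D 5 v * D 6 v - 2 * D 7 v * D 4 v - 2 * D 3 v * D 8 v
  | 12, v => -D 6 v ^ 2 + 10 * D 0 v * D 12 v - 2 * Dinf v * D 12 v + 2 * D 2 v * D 10 v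
      - 2 * D 1 v * D 11 v - 4 * D 3 v * D 9 v - 2 * D 4 v * D 8 v
  | _, _ => 0

/-- `δ_ν = −13·G0 + Σ_{j=1}^{12} ζ^{jν} G_j`. -/
def deltaF (ν : ℕ) (v : Fin 6 → ℂ) : ℂ :=
  -13 * Gs 0 v + ∑ j ∈ Finset.Icc 1 12, ζ ^ (j * ν) * Gs j v

/-- `δ_∞ = 13^2·G0`. -/
def deltaInf (v : Fin 6 → ℂ) : ℂ := 13 ^ 2 * Gs 0 v

/-- `Φ4 = Σ_ν w_ν + w_∞`. -/
def Phi4 (v : Fin 6 → ℂ) : ℂ := (∑ ν ∈ Finset.range 13, w ν v) + winf v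

/-- `Φ8 = Σ_ν w_ν^2 + w_∞^2`. -/
def Phi8 (v : Fin 6 → ℂ) : ℂ := (∑ ν ∈ Finset.range 13, w ν v ^ 2) + winf v ^ 2

/-- `Φ12′ = −(1/(13·30))(Σ_ν w_ν^3 + w_∞^3)`. -/
def Phi12' (v : Fin 6 → ℂ) : ℂ :=
  -(1 / (13 * 30)) * ((∑ ν ∈ Finset.range 13, w ν v ^ 3) + winf v ^ 3)

/-- `Φ16 = Σ_ν w_ν^4 + w_∞^4`. -/
def Phi16 (v : Fin 6 → ℂ) : ℂ := (∑ ν ∈ Finset.range 13, w ν v ^ 4) + winf v ^ 4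

/-- `Φ20 = (1/(13·25))(Σ_ν w_ν^5 + w_∞^5)`. -/
def Phi20 (v : Fin 6 → ℂ) : ℂ :=
  (1 / (13 * 25)) * ((∑ ν ∈ Finset.range 13, w ν v ^ 5) + winf v ^ 5)

/-- `Φ12 = −(1/(13·52))(Σ_ν δ_ν^2 + δ_∞^2)`. -/
def Phi12 (v : Fin 6 → ℂ) : ℂ :=
  -(1 / (13 * 52)) * ((∑ ν ∈ Finset.range 13, deltaF ν v ^ 2) + deltaInf v ^ 2)

/-- `Φ18 = (1/(13·6))(Σ_ν δ_ν^3 + δ_∞^3)`. -/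
def Phi18 (v : Fin 6 → ℂ) : ℂ :=
  (1 / (13 * 6)) * ((∑ ν ∈ Finset.range 13, deltaF ν v ^ 3) + deltaInf v ^ 3)

/-- `Φ30 = −(1/(13·1315))(Σ_ν δ_ν^5 + δ_∞^5)`. -/
def Phi30 (v : Fin 6 → ℂ) : ℂ :=
  -(1 / (13 * 1315)) * ((∑ ν ∈ Finset.range 13, deltaF ν v ^ 5) + deltaInf v ^ 5)

/-- `q^α = exp(2πiαz)`. -/
def qp (α : ℚ) (z : ℂ) : ℂ := Complex.exp (2 * Real.pi * Complex.I * (α : ℂ) * z)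

/-- `Σ_{n∈ℤ} (−1)^n q^{(13n^2+cn)/2}`. -/
def thetaSum (c : ℤ) (z : ℂ) : ℂ :=
  ∑' n : ℤ, (-1 : ℂ) ^ n * qp ((13 * (n : ℚ) ^ 2 + (c : ℚ) * (n : ℚ)) / 2) z

/-- The theta constants of order 13: `a_1, …, a_6`. -/
def thc : ℕ → ℂ → ℂ
  | 1, z => qp (121 / 104) z * thetaSum 11 z
  | 2, z => qp (49 / 104) z * thetaSum 7 z
  | 3, z => qp (25 / 104) z * thetaSum 5 z
  | 4, z => -(qp (9 / 104) z * thetaSum 3 z)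
  | 5, z => qp (81 / 104) z * thetaSum 9 z
  | 6, z => qp (1 / 104) z * thetaSum 1 z
  | _, _ => 0

/-- The vector `A(z) = (a1(z), …, a6(z))`. -/
def Avec (z : ℂ) : Fin 6 → ℂ := fun i => thc (i.val + 1) z

/-- The Dedekind eta function `η(z) = q^{1/24} Π_{n=1}^∞ (1−q^n)`. -/
def etaF (z : ℂ) : ℂ :=
  qp (1 / 24) z * ∏' n : ℕ, (1 - Complex.exp (2 * Real.pi * Complex.I * z) ^ (n + 1))

/-- The vector `(x1(z), …, x6(z))` with `x_i(z) = η(z)·a_i(z)`. -/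
def X (z : ℂ) : Fin 6 → ℂ := fun i => etaF z * thc (i.val + 1) z

/-- The discriminant `Δ(z) = η(z)^24`. -/
def Delta (z : ℂ) : ℂ := etaF z ^ 24

/-- The Eisenstein series `E4(z) = (1/2) Σ_{gcd(m,n)=1} (mz+n)^{−4}`. -/
def E4 (z : ℂ) : ℂ :=
  (1 / 2) * ∑' p : {p : ℤ × ℤ // Int.gcd p.1 p.2 = 1},
    ((p.1.1 : ℂ) * z + (p.1.2 : ℂ)) ^ (-4 : ℤ)

/-- The Eisenstein series `E6(z) = (1/2) Σ_{gcd(m,n)=1} (mz+n)^{−6}`. -/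
def E6 (z : ℂ) : ℂ :=
  (1 / 2) * ∑' p : {p : ℤ × ℤ // Int.gcd p.1 p.2 = 1},
    ((p.1.1 : ℂ) * z + (p.1.2 : ℂ)) ^ (-6 : ℤ)

lemma qp_mul (a b : ℚ) (z : ℂ) : qp a z * qp b z = qp (a + b) z := by
  simp only [qp, ← Complex.exp_add]
  congr 1
  push_cast
  ring

/-- The theta constant `Σ_{n∈ℤ} (−1)^n q^{(26n+c)^2/104}`. -/
def oddTheta (c : ℤ) (z : ℂ) : ℂ :=
  ∑' n : ℤ, (-1 : ℂ) ^ n * qp ((26 * (n : ℚ) + c) ^ 2 / 104) z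

/-- The theta constant `Σ_{n∈ℤ} q^{(26n+c)^2/52}`. -/
def evenTheta (c : ℤ) (z : ℂ) : ℂ :=
  ∑' n : ℤ, qp ((26 * (n : ℚ) + c) ^ 2 / 52) z

lemma summable_norm_qp_oddTheta (c : ℤ) {z : ℂ} (hz : 0 < z.im) :
    Summable fun n : ℤ => ‖(-1 : ℂ) ^ n * qp ((26 * (n : ℚ) + c) ^ 2 / 104) z‖ := by
  have hτ : 0 < (13 * z).im := by simpa using hz
  have h := ((summable_jacobiTheta₂_term_iff (c * z / 2) (13 * z)).2 hτ).mul_left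
    (qp ((c : ℚ) ^ 2 / 104) z)
  refine h.norm.congr fun n => ?_
  rw [norm_mul ((-1 : ℂ) ^ n), norm_zpow, norm_neg, norm_one, one_zpow, one_mul]
  congr 1
  simp only [qp, jacobiTheta₂_term, ← Complex.exp_add]
  congr 1
  push_cast
  ring

lemma summable_norm_qp_evenTheta (c : ℤ) {z : ℂ} (hz : 0 < z.im) :
    Summable fun n : ℤ => ‖qp ((26 * (n : ℚ) + c) ^ 2 / 52) z‖ := by
  have hτ : 0 < (26 * z).im := by simpa using hz
  have h := ((summable_jacobiTheta₂_term_iff (c * z) (26 * z)).2 hτ).mul_left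
    (qp ((c : ℚ) ^ 2 / 52) z)
  refine h.norm.congr fun n => ?_
  congr 1
  simp only [qp, jacobiTheta₂_term, ← Complex.exp_add]
  congr 1
  push_cast
  ring

lemma oddTheta_neg (c : ℤ) (z : ℂ) : oddTheta (-c) z = oddTheta c z := by
  rw [oddTheta, ← (Equiv.neg ℤ).tsum_eq]
  refine tsum_congr fun n => ?_
  rw [Equiv.neg_apply, zpow_neg, ← inv_zpow, inv_neg, inv_one]
  congr 2
  push_cast
  ring

lemma oddTheta_add_period (c : ℤ) (z : ℂ) : oddTheta (c + 26) z = -oddTheta c z := by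
  rw [oddTheta, oddTheta, ← (Equiv.addRight (1 : ℤ)).tsum_eq
    (fun n : ℤ => (-1 : ℂ) ^ n * qp ((26 * (n : ℚ) + c) ^ 2 / 104) z), ← tsum_neg]
  refine tsum_congr fun n => ?_
  rw [Equiv.coe_addRight, zpow_add_one₀ (by norm_num), mul_neg_one, neg_mul, neg_neg]
  congr 2
  push_cast
  ring

lemma evenTheta_add_period (c : ℤ) (z : ℂ) : evenTheta (c + 26) z = evenTheta c z := by
  rw [evenTheta, evenTheta, ← (Equiv.addRight (1 : ℤ)).tsum_eq
    (fun n : ℤ => qp ((26 * (n : ℚ) + c) ^ 2 / 52) z)]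
  refine tsum_congr fun n => ?_
  rw [Equiv.coe_addRight]
  congr 1
  push_cast
  ring

lemma qp_mul_thetaSum (c : ℤ) (z : ℂ) :
    qp ((c : ℚ) ^ 2 / 104) z * thetaSum c z = oddTheta c z := by
  rw [thetaSum, oddTheta, ← tsum_mul_left]
  refine tsum_congr fun n => ?_
  rw [mul_left_comm, qp_mul]
  congr 2
  ring

/-- The parametrization of `ℤ²` by the pairs of half-sums and half-differences, split according to
the parity of the sum of the coordinates. -/
def sumDiff : (ℤ × ℤ) ⊕ (ℤ × ℤ) → ℤ × ℤ :=
  Sum.elim (fun p => (p.1 + p.2, p.1 - p.2)) fun p => (p.1 + p.2 + 1, p.1 - p.2)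

lemma sumDiff_bijective : Function.Bijective sumDiff := by
  constructor
  · rintro (⟨i, j⟩ | ⟨i, j⟩) (⟨k, l⟩ | ⟨k, l⟩) h <;>
      simp only [sumDiff, Sum.elim_inl, Sum.elim_inr, Prod.mk.injEq, Sum.inl.injEq,
        Sum.inr.injEq, reduceCtorEq] at h ⊢ <;> omega
  · rintro ⟨m, n⟩
    rcases Int.emod_two_eq_zero_or_one (m + n) with h | h
    · refine ⟨Sum.inl ((m + n) / 2, (m - n) / 2), ?_⟩
      simp only [sumDiff, Sum.elim_inl, Prod.mk.injEq]
      omega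
    · refine ⟨Sum.inr ((m + n - 1) / 2, (m - n - 1) / 2), ?_⟩
      simp only [sumDiff, Sum.elim_inr, Prod.mk.injEq]
      omega

lemma oddTheta_mul_oddTheta (p r : ℤ) {z : ℂ} (hz : 0 < z.im) :
    oddTheta (p + r) z * oddTheta (p - r) z =
      evenTheta p z * evenTheta r z - evenTheta (p + 13) z * evenTheta (r + 13) z := by
  have hs := summable_norm_qp_oddTheta (p + r) hz
  have ht := summable_norm_qp_oddTheta (p - r) hz
  have hE (c : ℤ) := summable_norm_qp_evenTheta c hz
  rw [oddTheta, oddTheta, tsum_mul_tsum_of_summable_norm hs ht,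
    ← (Equiv.ofBijective _ sumDiff_bijective).tsum_eq]
  have hsum := (summable_mul_of_summable_norm hs ht).comp_injective sumDiff_bijective.injective
  refine (Summable.tsum_sum
    (hsum.comp_injective Sum.inl_injective) (hsum.comp_injective Sum.inr_injective)).trans ?_
  simp only [evenTheta]
  rw [tsum_mul_tsum_of_summable_norm (hE p) (hE r),
    tsum_mul_tsum_of_summable_norm (hE (p + 13)) (hE (r + 13)), sub_eq_add_neg (tsum _),
    ← tsum_neg]
  congr 1
  · refine tsum_congr fun ⟨i, j⟩ => ?_
    simp only [Function.comp_apply, sumDiff, Sum.elim_inl]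
    rw [mul_mul_mul_comm, qp_mul, qp_mul, ← zpow_add₀ (by norm_num),
      Even.neg_one_zpow ⟨i, by ring⟩, one_mul]
    congr 1
    push_cast
    ring
  · refine tsum_congr fun ⟨i, j⟩ => ?_
    simp only [Function.comp_apply, sumDiff, Sum.elim_inr]
    rw [mul_mul_mul_comm, qp_mul, qp_mul, ← zpow_add₀ (by norm_num),
      Odd.neg_one_zpow ⟨i, by ring⟩, neg_one_mul]
    congr 2
    push_cast
    ring

/-- The Weierstrass three-term relation. -/
lemma oddTheta_three_term (a b c d : ℤ) {z : ℂ} (hz : 0 < z.im) :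
    oddTheta (a + b + 13) z * oddTheta (a - b - 13) z *
        (oddTheta (c + d + 13) z * oddTheta (c - d - 13) z) -
      oddTheta (a + c + 13) z * oddTheta (a - c - 13) z *
        (oddTheta (b + d + 13) z * oddTheta (b - d - 13) z) +
      oddTheta (a + d + 13) z * oddTheta (a - d - 13) z *
        (oddTheta (b + c + 13) z * oddTheta (b - c - 13) z) = 0 := by
  have key (x y : ℤ) : oddTheta (x + y + 13) z * oddTheta (x - y - 13) z =
      evenTheta x z * evenTheta (y + 13) z - evenTheta (x + 13) z * evenTheta y z := by
    have h := oddTheta_mul_oddTheta x (y + 13) hz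
    rwa [← add_assoc, ← sub_sub, add_assoc y, show (13 + 13 : ℤ) = 26 by norm_num,
      evenTheta_add_period] at h
  simp only [key]
  ring

lemma oddTheta_reflect (c : ℤ) (z : ℂ) : oddTheta (26 - c) z = -oddTheta c z := by
  rw [← oddTheta_neg c, ← oddTheta_add_period, neg_add_eq_sub]

lemma sum_zeta13_pow (k : ℕ) :
    ∑ ν ∈ Finset.range 13, (ζ ^ k) ^ ν = if 13 ∣ k then 13 else 0 := by
  have hζ : IsPrimitiveRoot ζ 13 := by
    simpa [zeta13] using Complex.isPrimitiveRoot_exp 13 (by norm_num)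
  split_ifs with h
  · simp [(hζ.pow_eq_one_iff_dvd k).2 h]
  · have hne : ζ ^ k - 1 ≠ 0 := sub_ne_zero.2 fun h1 => h ((hζ.pow_eq_one_iff_dvd k).1 h1)
    refine (mul_eq_zero.1 ?_).resolve_left hne
    rw [mul_geom_sum, ← pow_mul, mul_comm, pow_mul, hζ.pow_eq_one, one_pow, sub_self]

lemma Phi4_eq (v : Fin 6 → ℂ) :
    Phi4 v = 26 * (A 0 v ^ 2 + A 1 v * A 5 v + A 2 v * A 3 v + A 4 v * A 6 v) := by
  let e : Fin 7 → ℕ := ![0, 1, 4, 9, 3, 12, 10]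
  have hw (ν : ℕ) :
      w ν v = ∑ i : Fin 7, ∑ j : Fin 7, (ζ ^ (e i + e j)) ^ ν * (A i v * A j v) := by
    have h : w ν v = (∑ i : Fin 7, (ζ ^ e i) ^ ν * A i v) ^ 2 := by
      simp [w, e, Fin.sum_univ_succ, pow_mul]
      ring
    rw [h, sq, Finset.sum_mul_sum]
    refine Finset.sum_congr rfl fun i _ => Finset.sum_congr rfl fun j _ => ?_
    rw [pow_add, mul_pow]
    ring
  have hsum : ∑ ν ∈ Finset.range 13, w ν v =
      ∑ i : Fin 7, ∑ j : Fin 7, (if 13 ∣ e i + e j then 13 else 0) * (A i v * A j v) := by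
    simp only [hw]
    rw [Finset.sum_comm]
    refine Finset.sum_congr rfl fun i _ => ?_
    rw [Finset.sum_comm]
    refine Finset.sum_congr rfl fun j _ => ?_
    rw [← Finset.sum_mul, sum_zeta13_pow]
  rw [Phi4, hsum, winf]
  simp [e, Fin.sum_univ_succ]
  ring

/-- `Φ4(x1(z),…,x6(z)) = 0` on ℍ. -/
theorem stmt_10 (z : ℂ) (hz : 0 < z.im) : Phi4 (X z) = 0 := by
  have h1 : thc 1 z = oddTheta 11 z := by rw [thc, ← qp_mul_thetaSum]; norm_num
  have h2 : thc 2 z = oddTheta 7 z := by rw [thc, ← qp_mul_thetaSum]; norm_num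
  have h3 : thc 3 z = oddTheta 5 z := by rw [thc, ← qp_mul_thetaSum]; norm_num
  have h4 : thc 4 z = -oddTheta 3 z := by rw [thc, ← qp_mul_thetaSum]; norm_num
  have h5 : thc 5 z = oddTheta 9 z := by rw [thc, ← qp_mul_thetaSum]; norm_num
  have h6 : thc 6 z = oddTheta 1 z := by rw [thc, ← qp_mul_thetaSum]; norm_num
  have r15 : oddTheta 15 z = -oddTheta 11 z := oddTheta_reflect 11 z
  have r17 : oddTheta 17 z = -oddTheta 9 z := oddTheta_reflect 9 z
  have r19 : oddTheta 19 z = -oddTheta 7 z := oddTheta_reflect 7 z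
  have r21 : oddTheta 21 z = -oddTheta 5 z := oddTheta_reflect 5 z
  have r23 : oddTheta 23 z = -oddTheta 3 z := oddTheta_reflect 3 z
  have r25 : oddTheta 25 z = -oddTheta 1 z := oddTheta_reflect 1 z
  have r27 : oddTheta 27 z = -oddTheta 1 z := oddTheta_add_period 1 z
  have r29 : oddTheta 29 z = -oddTheta 3 z := oddTheta_add_period 3 z
  have r31 : oddTheta 31 z = -oddTheta 5 z := oddTheta_add_period 5 z
  have r33 : oddTheta 33 z = -oddTheta 7 z := oddTheta_add_period 7 z
  have r35 : oddTheta 35 z = -oddTheta 9 z := oddTheta_add_period 9 z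
  have e1 := oddTheta_three_term 2 6 8 0 hz
  have e2 := oddTheta_three_term 4 12 10 0 hz
  have e3 := oddTheta_three_term 6 4 8 14 hz
  norm_num [oddTheta_neg, r15, r17, r19, r21, r23, r25, r27, r29, r31, r33, r35] at e1 e2 e3
  rw [Phi4_eq]
  simp only [A, X, Fin.isValue, Fin.coe_ofNat_eq_mod, Nat.reduceMod, Nat.reduceAdd,
    h1, h2, h3, h4, h5, h6]
  linear_combination 52 * etaF z ^ 4 * (e1 + e2 + 3 * e3)

end
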